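/- arXiv:0904.3367 — 7 statements merged into one kernel-verified Lean document; each statement's English description precedes it below -/
import Mathlib

section
/- Let Q ⊆ ℝⁿ be a nonempty closed convex set, let f : ℝⁿ → ℝ be convex and differentiable with gradient ∇f Lipschitz with constant L > 0, let x_0 ∈ Q, and let x* be a minimizer of f over Q. Suppose the sequences (x_k), (y_k), (z_k) satisfy: for every k ≥ 0, y_k minimizes x ↦ (L/2)‖x − x_k‖₂² + ⟨∇f(x_k), x − x_k⟩ over Q; z_k minimizes x ↦ (L/2)‖x − x_0‖₂² + Σ_{i=0}^{k} ((i+1)/2) ⟨∇f(x_i), x − x_i⟩ over Q; and x_{k+1} = τ_k z_k + (1 − τ_k) y_k with τ_k = 2/(k+3). Then for every k ≥ 1, f(y_k) − f(x*) ≤ 2 L ‖x* − x_0‖₂² / k². -/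
open RealInnerProductSpace Finset

theorem HasGradientAt.hasDerivAt_comp_add_smul {E : Type*} [NormedAddCommGroup E]
    [InnerProductSpace ℝ E] [CompleteSpace E] {f : E → ℝ} {g a d : E} {t : ℝ}
    (h : HasGradientAt f g (a + t • d)) :
    HasDerivAt (fun s : ℝ => f (a + s • d)) ⟪g, d⟫ t := by
  have hline : HasDerivAt (fun s : ℝ => a + s • d) d t := by
    simpa using ((hasDerivAt_id t).smul_const d).const_add a
  exact h.hasFDerivAt.comp_hasDerivAt t hline

/-- First-order lower bound for a convex function. -/
theorem ConvexOn.add_inner_gradient_le {E : Type*} [NormedAddCommGroup E]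
    [InnerProductSpace ℝ E] [CompleteSpace E] {f : E → ℝ} {g a b : E}
    (hf : ConvexOn ℝ Set.univ f) (h : HasGradientAt f g a) :
    f a + ⟪g, b - a⟫ ≤ f b := by
  have hconv : ConvexOn ℝ Set.univ (fun s : ℝ => f (a + s • (b - a))) := by
    have := hf.comp_affineMap (AffineMap.lineMap a b : ℝ →ᵃ[ℝ] E)
    simpa [Function.comp_def, AffineMap.lineMap_apply, add_comm] using this
  have hd : HasDerivAt (fun s : ℝ => f (a + s • (b - a))) ⟪g, b - a⟫ 0 :=
    HasGradientAt.hasDerivAt_comp_add_smul (by simpa using h)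
  have := hconv.le_slope_of_hasDerivAt (Set.mem_univ 0) (Set.mem_univ 1) one_pos hd
  simp [slope_def_field] at this
  linarith

/-- The descent lemma: quadratic upper bound for a function with Lipschitz gradient. -/
theorem le_add_inner_add_sq_of_lipschitz_gradient {E : Type*} [NormedAddCommGroup E]
    [InnerProductSpace ℝ E] [CompleteSpace E] {f : E → ℝ} {f' : E → E} {L : ℝ}
    (hf : ∀ x, HasGradientAt f (f' x) x) (hlip : ∀ x y, ‖f' x - f' y‖ ≤ L * ‖x - y‖) (a b : E) :
    f b ≤ f a + ⟪f' a, b - a⟫ + L / 2 * ‖b - a‖ ^ 2 := by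
  set d := b - a with hd
  have hderiv (t : ℝ) : HasDerivAt
      (fun s : ℝ => f (a + s • d) - s * ⟪f' a, d⟫ - L / 2 * ‖d‖ ^ 2 * s ^ 2)
      (⟪f' (a + t • d), d⟫ - ⟪f' a, d⟫ - L * ‖d‖ ^ 2 * t) t := by
    have h := ((hf (a + t • d)).hasDerivAt_comp_add_smul.sub
      ((hasDerivAt_id t).mul_const ⟪f' a, d⟫)).sub
      ((hasDerivAt_pow 2 t).const_mul (L / 2 * ‖d‖ ^ 2))
    refine h.congr_deriv ?_
    norm_num
    ring
  have hanti := antitoneOn_of_hasDerivWithinAt_nonpos (convex_Icc (0 : ℝ) 1)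
    (fun t _ => (hderiv t).continuousAt.continuousWithinAt)
    (fun t _ => (hderiv t).hasDerivWithinAt) (fun t ht => by
      rw [interior_Icc] at ht
      have hle : ⟪f' (a + t • d) - f' a, d⟫ ≤ L * (t * ‖d‖) * ‖d‖ := by
        refine (real_inner_le_norm _ _).trans (mul_le_mul_of_nonneg_right ?_ (norm_nonneg _))
        simpa [norm_smul, abs_of_pos ht.1] using hlip (a + t • d) a
      rw [inner_sub_left] at hle
      linarith)
  have h := hanti (Set.left_mem_Icc.2 zero_le_one) (Set.right_mem_Icc.2 zero_le_one) zero_le_one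
  simp [hd] at h
  linarith

/-- Quadratic growth of a strongly convex function away from a minimizer. -/
theorem StrongConvexOn.add_sq_norm_le_of_isMinOn {E : Type*} [NormedAddCommGroup E]
    [NormedSpace ℝ E] {s : Set E} {φ : E → ℝ} {m : ℝ} {z w : E}
    (hφ : StrongConvexOn s m φ) (hm : 0 ≤ m) (hmin : IsMinOn φ s z) (hz : z ∈ s) (hw : w ∈ s) :
    φ z + m / 2 * ‖w - z‖ ^ 2 ≤ φ w := by
  have key (t : ℝ) (h0 : 0 < t) (h1 : t ≤ 1) : (1 - t) * (m / 2 * ‖w - z‖ ^ 2) ≤ φ w - φ z := by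
    have hc := hφ.2 hw hz h0.le (sub_nonneg.2 h1) (by ring)
    have hmem := hφ.1 hw hz h0.le (sub_nonneg.2 h1) (by ring)
    have hle := isMinOn_iff.1 hmin _ hmem
    simp only [smul_eq_mul] at hc
    refine le_of_mul_le_mul_left ?_ h0
    linarith
  have hC : 0 ≤ m / 2 * ‖w - z‖ ^ 2 := by positivity
  have hlim : Filter.Tendsto (fun t : ℝ => (1 - t) * (m / 2 * ‖w - z‖ ^ 2))
      (nhdsWithin 0 (Set.Ioi 0)) (nhds (m / 2 * ‖w - z‖ ^ 2)) := by
    have : Continuous fun t : ℝ => (1 - t) * (m / 2 * ‖w - z‖ ^ 2) := by fun_prop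
    simpa using (this.tendsto 0).mono_left nhdsWithin_le_nhds
  have := le_of_tendsto hlim (Filter.eventually_of_mem
    (Ioc_mem_nhdsGT one_pos) fun t ht => key t ht.1 ht.2)
  linarith

theorem strongConvexOn_sq_norm_sub_add_sum_inner {E ι : Type*} [NormedAddCommGroup E]
    [InnerProductSpace ℝ E] {s : Set E} (hs : Convex ℝ s) (m : ℝ) (c : E) (I : Finset ι)
    (α : ι → ℝ) (g p : ι → E) :
    StrongConvexOn s m
      (fun w => m / 2 * ‖w - c‖ ^ 2 + ∑ i ∈ I, α i * ⟪g i, w - p i⟫) := by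
  refine ⟨hs, fun u _ v _ a b _ _ hab => le_of_eq ?_⟩
  obtain rfl : b = 1 - a := by linarith
  have hsum : ∑ i ∈ I, α i * ⟪g i, a • u + (1 - a) • v - p i⟫ =
      a * ∑ i ∈ I, α i * ⟪g i, u - p i⟫ + (1 - a) * ∑ i ∈ I, α i * ⟪g i, v - p i⟫ := by
    rw [mul_sum, mul_sum, ← sum_add_distrib]
    refine sum_congr rfl fun i _ => ?_
    simp only [inner_sub_right, inner_add_right, inner_smul_right]
    ring
  have hu : a • u + (1 - a) • v - c = a • (u - c) + (1 - a) • (v - c) := by module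
  have hv : u - v = (u - c) - (v - c) := by abel
  simp only [hsum, smul_eq_mul]
  rw [hu, hv, norm_add_sq_real, norm_sub_sq_real (u - c), norm_smul, norm_smul, mul_pow, mul_pow,
    Real.norm_eq_abs, Real.norm_eq_abs, sq_abs, sq_abs, inner_smul_left, inner_smul_right]
  simp only [conj_trivial]
  ring

theorem sum_range_add_one_div_two (k : ℕ) :
    ∑ i ∈ range k, ((i : ℝ) + 1) / 2 = k * (k + 1) / 4 := by
  induction k with
  | zero => simp
  | succ k ih => rw [sum_range_succ, ih]; push_cast; ring

/-- Convergence of each continuation step of NESTA: Nesterov's accelerated method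
with the Euclidean prox-function `(1/2)‖x - x₀‖²` satisfies
`f(y_k) - f(x*) ≤ 2 L ‖x* - x₀‖² / k²` for all `k ≥ 1`. -/
theorem nesta_continuation_step_convergence
    {n : ℕ} {Q : Set (EuclideanSpace ℝ (Fin n))}
    (hQne : Q.Nonempty) (hQclosed : IsClosed Q) (hQconvex : Convex ℝ Q)
    (f : EuclideanSpace ℝ (Fin n) → ℝ)
    (f' : EuclideanSpace ℝ (Fin n) → EuclideanSpace ℝ (Fin n))
    (hfconv : ConvexOn ℝ Set.univ f)
    (hfdiff : ∀ x, HasGradientAt f (f' x) x)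
    (L : ℝ) (hL : 0 < L)
    (hlip : ∀ x y, ‖f' x - f' y‖ ≤ L * ‖x - y‖)
    (xstar : EuclideanSpace ℝ (Fin n))
    (hxstar : xstar ∈ Q ∧ ∀ w ∈ Q, f xstar ≤ f w)
    (x y z : ℕ → EuclideanSpace ℝ (Fin n))
    (hx0 : x 0 ∈ Q)
    (hy : ∀ k : ℕ, y k ∈ Q ∧ ∀ w ∈ Q,
      L / 2 * ‖y k - x k‖ ^ 2 + ⟪f' (x k), y k - x k⟫ ≤
        L / 2 * ‖w - x k‖ ^ 2 + ⟪f' (x k), w - x k⟫)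
    (hz : ∀ k : ℕ, z k ∈ Q ∧ ∀ w ∈ Q,
      L / 2 * ‖z k - x 0‖ ^ 2
          + ∑ i ∈ range (k + 1), ((i : ℝ) + 1) / 2 * ⟪f' (x i), z k - x i⟫ ≤
        L / 2 * ‖w - x 0‖ ^ 2
          + ∑ i ∈ range (k + 1), ((i : ℝ) + 1) / 2 * ⟪f' (x i), w - x i⟫)
    (hxk : ∀ k : ℕ,
      x (k + 1) = (2 / ((k : ℝ) + 3)) • z k + (1 - 2 / ((k : ℝ) + 3)) • y k) :
    ∀ k : ℕ, 1 ≤ k →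
      f (y k) - f xstar ≤ 2 * L * ‖xstar - x 0‖ ^ 2 / (k : ℝ) ^ 2 := by
  have hupper (k : ℕ) {w : EuclideanSpace ℝ (Fin n)} (hw : w ∈ Q) :
      f (y k) ≤ f (x k) + (L / 2 * ‖w - x k‖ ^ 2 + ⟪f' (x k), w - x k⟫) := by
    have h₁ := le_add_inner_add_sq_of_lipschitz_gradient hfdiff hlip (x k) (y k)
    have h₂ := (hy k).2 w hw
    linarith
  have hlower (a b : EuclideanSpace ℝ (Fin n)) : f a + ⟪f' a, b - a⟫ ≤ f b :=
    hfconv.add_inner_gradient_le (hfdiff a)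
  have hest (k : ℕ) : ((k : ℝ) + 1) * (k + 2) / 4 * f (y k) ≤
      L / 2 * ‖z k - x 0‖ ^ 2
        + ∑ i ∈ range (k + 1), ((i : ℝ) + 1) / 2 * ⟪f' (x i), z k - x i⟫
        + ∑ i ∈ range (k + 1), ((i : ℝ) + 1) / 2 * f (x i) := by
    induction k with
    | zero =>
      have h := hupper 0 (hz 0).1
      have : 0 ≤ L / 2 * ‖z 0 - x 0‖ ^ 2 := by positivity
      simp
      linarith
    | succ k ih =>
      have hgrow := (strongConvexOn_sq_norm_sub_add_sum_inner hQconvex L (x 0) (range (k + 1))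
        (fun i => ((i : ℝ) + 1) / 2) (fun i => f' (x i)) x).add_sq_norm_le_of_isMinOn hL.le
        (isMinOn_iff.2 (hz k).2) (hz k).1 (hz (k + 1)).1
      rw [sum_range_succ _ (k + 1), sum_range_succ _ (k + 1)]
      set τ : ℝ := 2 / ((k : ℝ) + 3) with hτ
      have hk : (0 : ℝ) < (k : ℝ) + 3 := by positivity
      have hτk : τ * (k + 3) = 2 := by rw [hτ]; field_simp
      have hτ0 : 0 ≤ τ := by positivity
      have hτ1 : 0 ≤ 1 - τ := by
        rw [hτ, sub_nonneg, div_le_one hk]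
        linarith [(Nat.cast_nonneg k : (0 : ℝ) ≤ k)]
      have hu := hupper (k + 1) (hQconvex (hz (k + 1)).1 (hy k).1 hτ0 hτ1 (by ring))
      have hl := hlower (x (k + 1)) (y k)
      have hstep : τ • z (k + 1) + (1 - τ) • y k - x (k + 1) = τ • (z (k + 1) - z k) := by
        rw [hxk k]; module
      have hinner : ⟪f' (x (k + 1)), τ • z (k + 1) + (1 - τ) • y k - x (k + 1)⟫ =
          τ * ⟪f' (x (k + 1)), z (k + 1) - x (k + 1)⟫
            + (1 - τ) * ⟪f' (x (k + 1)), y k - x (k + 1)⟫ := by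
        rw [← inner_smul_right, ← inner_smul_right, ← inner_add_right]
        congr 1
        module
      rw [hinner, hstep, norm_smul, mul_pow, Real.norm_eq_abs, sq_abs] at hu
      have hu' := mul_le_mul_of_nonneg_left hu
        (by positivity : (0 : ℝ) ≤ ((k : ℝ) + 2) * (k + 3) / 4)
      have hl' := mul_le_mul_of_nonneg_left hl
        (by positivity : (0 : ℝ) ≤ ((k : ℝ) + 1) * (k + 2) / 4)
      have hweight : ((k : ℝ) + 2) * (k + 3) / 4 * τ = (k + 2) / 2 := by
        linear_combination ((k : ℝ) + 2) / 4 * hτk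
      have hcoef : ((k : ℝ) + 2) * (k + 3) / 4 * τ ^ 2 ≤ 1 := by
        have : ((k : ℝ) + 2) * (k + 3) / 4 * τ ^ 2 = 1 - τ / 2 := by
          linear_combination (((k : ℝ) + 2) / 4 * τ + 1 / 2) * hτk
        linarith
      have hsq := mul_le_mul_of_nonneg_right hcoef
        (by positivity : 0 ≤ L / 2 * ‖z (k + 1) - z k‖ ^ 2)
      have hexpand : ((k : ℝ) + 2) * (k + 3) / 4 * (f (x (k + 1))
          + (L / 2 * (τ ^ 2 * ‖z (k + 1) - z k‖ ^ 2)
            + (τ * ⟪f' (x (k + 1)), z (k + 1) - x (k + 1)⟫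
              + (1 - τ) * ⟪f' (x (k + 1)), y k - x (k + 1)⟫))) =
          ((k : ℝ) + 2) * (k + 3) / 4 * f (x (k + 1))
          + ((k : ℝ) + 2) * (k + 3) / 4 * τ ^ 2 * (L / 2 * ‖z (k + 1) - z k‖ ^ 2)
          + (k + 2) / 2 * ⟪f' (x (k + 1)), z (k + 1) - x (k + 1)⟫
          + ((k : ℝ) + 1) * (k + 2) / 4 * ⟪f' (x (k + 1)), y k - x (k + 1)⟫ := by
        linear_combination (⟪f' (x (k + 1)), z (k + 1) - x (k + 1)⟫
          - ⟪f' (x (k + 1)), y k - x (k + 1)⟫) * hweight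
      rw [hexpand] at hu'
      push_cast
      linarith
  intro k hk
  have hk0 : (0 : ℝ) < k := by exact_mod_cast hk
  have hsum : ∑ i ∈ range (k + 1), ((i : ℝ) + 1) / 2 * ⟪f' (x i), xstar - x i⟫
      + ∑ i ∈ range (k + 1), ((i : ℝ) + 1) / 2 * f (x i) ≤
      ((k : ℝ) + 1) * (k + 2) / 4 * f xstar := by
    have hA : ((k : ℝ) + 1) * (k + 2) / 4 = ∑ i ∈ range (k + 1), ((i : ℝ) + 1) / 2 := by
      rw [sum_range_add_one_div_two]; push_cast; ring
    rw [hA, sum_mul, ← sum_add_distrib]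
    refine sum_le_sum fun i _ => ?_
    rw [← mul_add]
    exact mul_le_mul_of_nonneg_left (by linarith [hlower (x i) xstar]) (by positivity)
  have hbound := (hz k).2 xstar hxstar.1
  have hfinal := hest k
  have hgap : 0 ≤ f (y k) - f xstar := sub_nonneg.2 (hxstar.2 _ (hy k).1)
  have hk2 : (k : ℝ) ^ 2 * (f (y k) - f xstar) ≤
      ((k : ℝ) + 1) * (k + 2) * (f (y k) - f xstar) :=
    mul_le_mul_of_nonneg_right (by nlinarith) hgap
  rw [le_div_iff₀ (by positivity)]
  linarith
end

section
/- For every μ > 0 and every x ∈ ℝⁿ, the supremum defining f_μ(x) is attained and f_μ(x) = Σ_{i=1}^{n} h_μ(x_i), where h_μ(t) = t²/(2μ) if |t| ≤ μ and h_μ(t) = |t| − μ/2 otherwise; that is, the smoothed ℓ₁ norm is the Huber function. -/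
open RealInnerProductSpace Finset

theorem isGreatest_huber {μ : ℝ} (hμ : 0 < μ) (t : ℝ) :
    IsGreatest ((fun v : ℝ => v * t - μ / 2 * v ^ 2) '' {v : ℝ | |v| ≤ 1})
      (if |t| ≤ μ then t ^ 2 / (2 * μ) else |t| - μ / 2) := by
  split_ifs with h
  · constructor
    · refine ⟨t / μ, ?_, ?_⟩
      · rw [Set.mem_ofPred_eq, abs_div, abs_of_pos hμ]
        exact (div_le_one hμ).2 h
      · field_simp
        ring
    · rintro _ ⟨v, -, rfl⟩
      rw [le_div_iff₀ (by positivity)]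
      nlinarith [sq_nonneg (t - μ * v)]
  · constructor
    · obtain ht | ht := le_total 0 t
      · exact ⟨1, by simp, by simp [abs_of_nonneg ht]⟩
      · exact ⟨-1, by simp, by simp [abs_of_nonpos ht]⟩
    · rintro _ ⟨v, hv, rfl⟩
      have hvt : v * t ≤ |v| * |t| := (le_abs_self _).trans (abs_mul v t).le
      have hv1 : |v| ≤ 1 := hv
      have hsq : |v| ^ 2 = v ^ 2 := sq_abs v
      dsimp only
      nlinarith [mul_nonneg (sub_nonneg.2 hv1) (sub_nonneg.2 (not_le.1 h).le),
        mul_nonneg hμ.le (sq_nonneg (1 - |v|))]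

theorem inner_sub_mul_norm_sq_eq_sum {ι : Type*} [Fintype ι] (c : ℝ)
    (u x : EuclideanSpace ℝ ι) :
    ⟪u, x⟫ - c * ‖u‖ ^ 2 = ∑ i, (u i * x i - c * u i ^ 2) := by
  simp [PiLp.inner_apply, EuclideanSpace.real_norm_sq_eq, Finset.mul_sum,
    Finset.sum_sub_distrib, mul_comm]

/-- The supremum defining the smoothed ℓ₁ norm
`f_μ(x) = sup { ⟨u,x⟩ - (μ/2)‖u‖₂² : ‖u‖_∞ ≤ 1 }` is attained and equals the
Huber function `∑ i h_μ(x_i)`, where `h_μ(t) = t²/(2μ)` if `|t| ≤ μ` and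
`h_μ(t) = |t| - μ/2` otherwise. -/
theorem smoothed_l1_is_huber {n : ℕ} (μ : ℝ) (hμ : 0 < μ)
    (x : EuclideanSpace ℝ (Fin n)) :
    IsGreatest
      ((fun u : EuclideanSpace ℝ (Fin n) => ⟪u, x⟫ - μ / 2 * ‖u‖ ^ 2) ''
        {u : EuclideanSpace ℝ (Fin n) | ∀ i, |u i| ≤ 1})
      (∑ i, if |x i| ≤ μ then x i ^ 2 / (2 * μ) else |x i| - μ / 2) := by
  choose v hv hvx using fun i => (isGreatest_huber hμ (x i)).1
  constructor
  · refine ⟨WithLp.toLp 2 v, hv, ?_⟩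
    simp only [inner_sub_mul_norm_sq_eq_sum]
    exact Finset.sum_congr rfl fun i _ => hvx i
  · rintro _ ⟨u, hu, rfl⟩
    simp only [inner_sub_mul_norm_sq_eq_sum]
    exact Finset.sum_le_sum fun i _ => (isGreatest_huber hμ (x i)).2 ⟨u i, hu i, rfl⟩
end

section
/- For every μ > 0, the gradient of the smoothed ℓ₁ norm f_μ is Lipschitz with constant 1/μ: for all x, y ∈ ℝⁿ, ‖∇f_μ(x) − ∇f_μ(y)‖₂ ≤ (1/μ)‖x − y‖₂. -/
open RealInnerProductSpace

/-- The smoothed ℓ₁ norm: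
`f_μ(x) = sup { ⟨u,x⟩ - (μ/2)‖u‖₂² : u ∈ ℝⁿ, ‖u‖_∞ ≤ 1 }`. -/
noncomputable def smoothedL1 {n : ℕ} (μ : ℝ) (x : EuclideanSpace ℝ (Fin n)) : ℝ :=
  sSup ((fun u : EuclideanSpace ℝ (Fin n) => ⟪u, x⟫ - μ / 2 * ‖u‖ ^ 2) ''
    {u : EuclideanSpace ℝ (Fin n) | ∀ i, |u i| ≤ 1})

section BoxSupport

variable {n : ℕ}

theorem convex_setOf_forall_abs_le_one :
    Convex ℝ {u : EuclideanSpace ℝ (Fin n) | ∀ i, |u i| ≤ 1} := by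
  intro u hu v hv a b ha hb hab i
  have hui := abs_le.1 (hu i)
  have hvi := abs_le.1 (hv i)
  simp only [PiLp.add_apply, PiLp.smul_apply, smul_eq_mul]
  exact abs_le.2 ⟨by nlinarith, by nlinarith⟩

theorem isClosed_setOf_forall_abs_le_one :
    IsClosed {u : EuclideanSpace ℝ (Fin n) | ∀ i, |u i| ≤ 1} := by
  simp only [Set.ofPred_forall]
  exact isClosed_iInter fun i => isClosed_le (by fun_prop) continuous_const

/-- Variational characterization of the projection of `μ⁻¹ • x` onto the unit box. -/
theorem exists_forall_abs_le_one_inner_le_zero {μ : ℝ} (hμ : 0 < μ)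
    (x : EuclideanSpace ℝ (Fin n)) :
    ∃ u : EuclideanSpace ℝ (Fin n), (∀ i, |u i| ≤ 1) ∧
      ∀ w : EuclideanSpace ℝ (Fin n), (∀ i, |w i| ≤ 1) → ⟪x - μ • u, w - u⟫ ≤ 0 := by
  obtain ⟨u, hu, hmin⟩ := exists_norm_eq_iInf_of_complete_convex
    (K := {u : EuclideanSpace ℝ (Fin n) | ∀ i, |u i| ≤ 1}) ⟨0, by simp⟩
    isClosed_setOf_forall_abs_le_one.isComplete convex_setOf_forall_abs_le_one (μ⁻¹ • x)
  refine ⟨u, hu, fun w hw => ?_⟩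
  have h := (norm_eq_iInf_iff_real_inner_le_zero convex_setOf_forall_abs_le_one hu).1 hmin w hw
  have hx : x - μ • u = μ • (μ⁻¹ • x - u) := by
    rw [smul_sub, smul_inv_smul₀ hμ.ne']
  rw [hx, real_inner_smul_left]
  exact mul_nonpos_of_nonneg_of_nonpos hμ.le h

theorem isGreatest_smoothedL1 {μ : ℝ} (hμ : 0 < μ) {x u : EuclideanSpace ℝ (Fin n)}
    (hu : ∀ i, |u i| ≤ 1)
    (h : ∀ w : EuclideanSpace ℝ (Fin n), (∀ i, |w i| ≤ 1) → ⟪x - μ • u, w - u⟫ ≤ 0) :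
    IsGreatest ((fun u : EuclideanSpace ℝ (Fin n) => ⟪u, x⟫ - μ / 2 * ‖u‖ ^ 2) ''
      {u : EuclideanSpace ℝ (Fin n) | ∀ i, |u i| ≤ 1}) (⟪u, x⟫ - μ / 2 * ‖u‖ ^ 2) := by
  refine ⟨⟨u, hu, rfl⟩, ?_⟩
  rintro _ ⟨w, hw, rfl⟩
  have h₁ := h w hw
  have h₂ : 0 ≤ μ * ‖w - u‖ ^ 2 := by positivity
  rw [norm_sub_sq_real] at h₂
  simp only [inner_sub_left, inner_sub_right, real_inner_smul_left,
    real_inner_self_eq_norm_sq] at h₁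
  rw [real_inner_comm w x, real_inner_comm u x, real_inner_comm w u] at h₁
  dsimp only
  linarith

theorem le_smoothedL1 {μ : ℝ} (hμ : 0 < μ) (x : EuclideanSpace ℝ (Fin n))
    {w : EuclideanSpace ℝ (Fin n)} (hw : ∀ i, |w i| ≤ 1) :
    ⟪w, x⟫ - μ / 2 * ‖w‖ ^ 2 ≤ smoothedL1 μ x := by
  obtain ⟨u, hu, h⟩ := exists_forall_abs_le_one_inner_le_zero hμ x
  exact le_csSup (isGreatest_smoothedL1 hμ hu h).bddAbove ⟨w, hw, rfl⟩

/-- Where it exists, the gradient of `smoothedL1 μ` is the maximizer. -/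
theorem eq_of_hasGradientAt_smoothedL1 {μ : ℝ} (hμ : 0 < μ) {x u v : EuclideanSpace ℝ (Fin n)}
    (hu : ∀ i, |u i| ≤ 1)
    (h : ∀ w : EuclideanSpace ℝ (Fin n), (∀ i, |w i| ≤ 1) → ⟪x - μ • u, w - u⟫ ≤ 0)
    (hv : HasGradientAt (smoothedL1 μ) v x) : v = u := by
  have hx : smoothedL1 μ x = ⟪u, x⟫ - μ / 2 * ‖u‖ ^ 2 :=
    (isGreatest_smoothedL1 hμ hu h).csSup_eq
  have hmin : IsLocalMin (fun z => smoothedL1 μ z - innerSL ℝ u z) x := by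
    refine Filter.Eventually.of_forall fun z => ?_
    have hz := le_smoothedL1 hμ z hu
    simp only [innerSL_apply_apply]
    linarith
  have hd := hmin.hasFDerivAt_eq_zero (hv.hasFDerivAt.sub (innerSL ℝ u).hasFDerivAt)
  refine ext_inner_right ℝ fun z => ?_
  have hz := congrArg (fun L => L z) hd
  simpa [sub_eq_zero] using hz

end BoxSupport

/-- For every `μ > 0`, the gradient of the smoothed ℓ₁ norm `f_μ` is Lipschitz
with constant `1/μ`. -/
theorem smoothed_l1_gradient_lipschitz {n : ℕ} (μ : ℝ) (hμ : 0 < μ)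
    (g : EuclideanSpace ℝ (Fin n) → EuclideanSpace ℝ (Fin n))
    (hg : ∀ x, HasGradientAt (smoothedL1 μ) (g x) x) :
    ∀ x y : EuclideanSpace ℝ (Fin n), ‖g x - g y‖ ≤ 1 / μ * ‖x - y‖ := by
  intro x y
  obtain ⟨u, hu, hux⟩ := exists_forall_abs_le_one_inner_le_zero hμ x
  obtain ⟨v, hv, hvy⟩ := exists_forall_abs_le_one_inner_le_zero hμ y
  rw [eq_of_hasGradientAt_smoothedL1 hμ hu hux (hg x),
    eq_of_hasGradientAt_smoothedL1 hμ hv hvy (hg y)]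
  have hinner : μ * ‖u - v‖ ^ 2 ≤ ⟪x - y, u - v⟫ := by
    have h₁ := hux v hv
    have h₂ := hvy u hu
    have h₃ : ⟪x - y, u - v⟫ - μ * ‖u - v‖ ^ 2 =
        -⟪x - μ • u, v - u⟫ - ⟪y - μ • v, u - v⟫ := by
      rw [← real_inner_self_eq_norm_sq]
      simp only [inner_sub_left, inner_sub_right, real_inner_smul_left]
      ring
    linarith
  have hcs : μ * ‖u - v‖ ^ 2 ≤ ‖x - y‖ * ‖u - v‖ := hinner.trans (real_inner_le_norm _ _)
  rw [one_div, ← div_eq_inv_mul, le_div_iff₀ hμ]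
  rcases (norm_nonneg (u - v)).eq_or_lt with h₀ | h₀
  · rw [← h₀, zero_mul]
    exact norm_nonneg _
  · exact le_of_mul_le_mul_right (by linarith) h₀
end

section
/- The maximizer map x ↦ u_μ(x) is Lipschitz: for all x, y ∈ ℝⁿ, ‖u_μ(x) − u_μ(y)‖₂ ≤ (‖W‖/(μ σ_d)) ‖x − y‖₂, where ‖W‖ is the operator norm of W. -/
open RealInnerProductSpace

/-- Quadratic growth: a maximizer over a set of a linear functional minus a nonnegative multiple of
a strongly convex function beats every other point by a multiple of the squared distance. -/
lemma StrongConvexOn.sq_norm_sub_le_of_isMaxOn {E : Type*} [NormedAddCommGroup E]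
    [InnerProductSpace ℝ E] {s : Set E} {f : E → ℝ} {m c : ℝ} (hf : StrongConvexOn s m f)
    (hc : 0 ≤ c) {a u v : E} (hu : u ∈ s) (hv : v ∈ s)
    (hmax : IsMaxOn (fun w => ⟪w, a⟫ - c * f w) s u) :
    c * (m / 2 * ‖u - v‖ ^ 2) ≤ (⟪u, a⟫ - c * f u) - (⟪v, a⟫ - c * f v) := by
  have key : ∀ t ∈ Set.Ioo (0 : ℝ) 1, (1 - t) * (c * (m / 2 * ‖u - v‖ ^ 2)) ≤
      (⟪u, a⟫ - c * f u) - (⟪v, a⟫ - c * f v) := by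
    rintro t ⟨ht0, ht1⟩
    have hle := hf.2 hu hv (sub_nonneg.2 ht1.le) ht0.le (sub_add_cancel 1 t)
    have hopt := hmax (hf.1 hu hv (sub_nonneg.2 ht1.le) ht0.le (sub_add_cancel 1 t))
    simp only [Set.mem_ofPred_eq, inner_add_left, real_inner_smul_left] at hopt
    simp only [smul_eq_mul] at hle
    have hmul := mul_le_mul_of_nonneg_left hle hc
    refine le_of_mul_le_mul_left ?_ ht0
    linarith
  have hlim : Filter.Tendsto (fun t : ℝ => (1 - t) * (c * (m / 2 * ‖u - v‖ ^ 2)))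
      (nhdsWithin 0 (Set.Ioi 0)) (nhds (c * (m / 2 * ‖u - v‖ ^ 2))) :=
    tendsto_nhdsWithin_of_tendsto_nhds (Continuous.tendsto' (by fun_prop) _ _ (by simp))
  exact le_of_tendsto hlim (Filter.mem_of_superset (Ioo_mem_nhdsGT one_pos) key)

/-- The maximizer map `x ↦ u_μ(x)` of `u ↦ ⟨u, Wx⟩ - μ p_d(u)` over `Q_d` is
Lipschitz with constant `‖W‖/(μ σ_d)`. -/
theorem maximizer_map_lipschitz {n p : ℕ}
    (Qd : Set (EuclideanSpace ℝ (Fin p)))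
    (hQdne : Qd.Nonempty) (hQdcomp : IsCompact Qd) (hQdconv : Convex ℝ Qd)
    (pd : EuclideanSpace ℝ (Fin p) → ℝ) (hpd : Continuous pd)
    (σd : ℝ) (hσd : 0 < σd)
    (hstrong : ConvexOn ℝ Qd (fun u => pd u - σd / 2 * ‖u‖ ^ 2))
    (W : EuclideanSpace ℝ (Fin n) →L[ℝ] EuclideanSpace ℝ (Fin p))
    (μ : ℝ) (hμ : 0 < μ)
    (umu : EuclideanSpace ℝ (Fin n) → EuclideanSpace ℝ (Fin p))
    (humu : ∀ x, umu x ∈ Qd ∧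
      ∀ v ∈ Qd, ⟪v, W x⟫ - μ * pd v ≤ ⟪umu x, W x⟫ - μ * pd (umu x)) :
    ∀ x y : EuclideanSpace ℝ (Fin n),
      ‖umu x - umu y‖ ≤ ‖W‖ / (μ * σd) * ‖x - y‖ := by
  intro x y
  have hsc : StrongConvexOn Qd σd pd := strongConvexOn_iff_convex.2 hstrong
  have hx := hsc.sq_norm_sub_le_of_isMaxOn hμ.le (humu x).1 (humu y).1 (humu x).2
  have hy := hsc.sq_norm_sub_le_of_isMaxOn hμ.le (humu y).1 (humu x).1 (humu y).2
  rw [norm_sub_rev] at hy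
  have hinner : ⟪umu x - umu y, W (x - y)⟫ ≤ ‖umu x - umu y‖ * (‖W‖ * ‖x - y‖) :=
    (real_inner_le_norm _ _).trans (by gcongr; exact W.le_opNorm _)
  simp only [map_sub, inner_sub_left, inner_sub_right] at hinner
  rw [div_mul_eq_mul_div, le_div_iff₀ (mul_pos hμ hσd)]
  rcases (norm_nonneg (umu x - umu y)).eq_or_lt with h | h
  · rw [← h, zero_mul]
    positivity
  · refine le_of_mul_le_mul_left ?_ h
    linarith
end

section
/- The function f_μ(x) = max_{u ∈ Q_d} (⟨u, Wx⟩ − μ p_d(u)) is convex on ℝⁿ and differentiable at every x ∈ ℝⁿ, with gradient ∇f_μ(x) = W* u_μ(x), where W* is the adjoint of W. -/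
open RealInnerProductSpace

section StronglyConvex

variable {F : Type*} [NormedAddCommGroup F] [InnerProductSpace ℝ F]

/-- A maximizer over `Q` of a linear functional minus a multiple of a strongly convex function
satisfies a quadratic growth condition. -/
theorem quadratic_growth_of_maximizer {Q : Set F} {d : F → ℝ} {σ μ : ℝ} (hμ : 0 < μ)
    (hd : ConvexOn ℝ Q (fun u => d u - σ / 2 * ‖u‖ ^ 2)) {w u : F} (hu : u ∈ Q)
    (hmax : ∀ v ∈ Q, ⟪v, w⟫ - μ * d v ≤ ⟪u, w⟫ - μ * d u) {v : F} (hv : v ∈ Q) :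
    ⟪v, w⟫ - μ * d v + μ * σ / 4 * ‖u - v‖ ^ 2 ≤ ⟪u, w⟫ - μ * d u := by
  have hhalf : (0 : ℝ) ≤ 1 / 2 := by norm_num
  have hsum : (1 / 2 : ℝ) + 1 / 2 = 1 := by norm_num
  have hm := hmax _ (hd.1 hu hv hhalf hhalf hsum)
  have hc := hd.2 hu hv hhalf hhalf hsum
  simp only [smul_eq_mul] at hc
  have hnorm : ‖(1 / 2 : ℝ) • u + (1 / 2 : ℝ) • v‖ ^ 2
      = ‖u‖ ^ 2 / 2 + ‖v‖ ^ 2 / 2 - ‖u - v‖ ^ 2 / 4 := by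
    rw [← smul_add, norm_smul, mul_pow, norm_add_sq_real, norm_sub_sq_real]
    norm_num
    ring
  rw [hnorm] at hc
  rw [inner_add_left, real_inner_smul_left, real_inner_smul_left] at hm
  have := mul_le_mul_of_nonneg_left hc hμ.le
  linarith

/-- The maximizer depends on the linear functional in a Lipschitz way. -/
theorem norm_maximizer_sub_le {Q : Set F} {d : F → ℝ} {σ μ : ℝ} (hσ : 0 < σ) (hμ : 0 < μ)
    (hd : ConvexOn ℝ Q (fun u => d u - σ / 2 * ‖u‖ ^ 2)) {w z u v : F} (hu : u ∈ Q) (hv : v ∈ Q)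
    (humax : ∀ q ∈ Q, ⟪q, w⟫ - μ * d q ≤ ⟪u, w⟫ - μ * d u)
    (hvmax : ∀ q ∈ Q, ⟪q, z⟫ - μ * d q ≤ ⟪v, z⟫ - μ * d v) :
    ‖v - u‖ ≤ 2 / (μ * σ) * ‖z - w‖ := by
  have h₁ := quadratic_growth_of_maximizer hμ hd hu humax hv
  have h₂ := quadratic_growth_of_maximizer hμ hd hv hvmax hu
  have hcs := real_inner_le_norm (v - u) (z - w)
  rw [inner_sub_left, inner_sub_right, inner_sub_right] at hcs
  rw [norm_sub_rev u v] at h₁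
  have hmul : 0 < μ * σ := mul_pos hμ hσ
  have key : ‖v - u‖ * (μ * σ * ‖v - u‖) ≤ ‖v - u‖ * (2 * ‖z - w‖) := by linarith
  rw [div_mul_eq_mul_div, le_div_iff₀ hmul, mul_comm]
  rcases (norm_nonneg (v - u)).eq_or_lt with h | h
  · rw [← h]
    simp
  · exact le_of_mul_le_mul_left key h

end StronglyConvex

/-- The function `f_μ(x) = max_{u ∈ Q_d} (⟨u, Wx⟩ - μ p_d(u))` is convex on ℝⁿ
and differentiable at every `x`, with gradient `∇f_μ(x) = W* u_μ(x)`. -/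
theorem fmu_convex_and_gradient {n p : ℕ}
    (Qd : Set (EuclideanSpace ℝ (Fin p)))
    (hQdne : Qd.Nonempty) (hQdcomp : IsCompact Qd) (hQdconv : Convex ℝ Qd)
    (pd : EuclideanSpace ℝ (Fin p) → ℝ) (hpd : Continuous pd)
    (σd : ℝ) (hσd : 0 < σd)
    (hstrong : ConvexOn ℝ Qd (fun u => pd u - σd / 2 * ‖u‖ ^ 2))
    (W : EuclideanSpace ℝ (Fin n) →L[ℝ] EuclideanSpace ℝ (Fin p))
    (μ : ℝ) (hμ : 0 < μ)
    (umu : EuclideanSpace ℝ (Fin n) → EuclideanSpace ℝ (Fin p))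
    (humu : ∀ x, umu x ∈ Qd ∧
      ∀ v ∈ Qd, ⟪v, W x⟫ - μ * pd v ≤ ⟪umu x, W x⟫ - μ * pd (umu x))
    (fmu : EuclideanSpace ℝ (Fin n) → ℝ)
    (hfmu : ∀ x, IsGreatest ((fun u => ⟪u, W x⟫ - μ * pd u) '' Qd) (fmu x)) :
    ConvexOn ℝ Set.univ fmu ∧
      ∀ x, HasGradientAt fmu (ContinuousLinearMap.adjoint W (umu x)) x := by
  have hval : ∀ x, fmu x = ⟪umu x, W x⟫ - μ * pd (umu x) := fun x =>
    (hfmu x).unique ⟨⟨umu x, (humu x).1, rfl⟩, by rintro _ ⟨v, hv, rfl⟩; exact (humu x).2 v hv⟩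
  refine ⟨⟨convex_univ, fun x _ y _ a b ha hb hab => ?_⟩, fun x => ?_⟩
  · set u := umu (a • x + b • y) with hu
    have huQ : u ∈ Qd := (humu _).1
    have hx := mul_le_mul_of_nonneg_left ((humu x).2 u huQ) ha
    have hy := mul_le_mul_of_nonneg_left ((humu y).2 u huQ) hb
    rw [hval, hval x, hval y, ← hu, map_add, map_smul, map_smul, inner_add_right,
      real_inner_smul_right, real_inner_smul_right, smul_eq_mul, smul_eq_mul]
    linear_combination hx + hy + μ * pd u * hab
  · rw [hasGradientAt_iff_isLittleO]
    refine Asymptotics.IsBigO.trans_isLittleO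
      (Asymptotics.IsBigO.of_bound (2 / (μ * σd) * ‖W‖ ^ 2) (Filter.Eventually.of_forall fun y => ?_))
      (Asymptotics.isLittleO_pow_sub_sub x one_lt_two)
    have hlow := (humu y).2 (umu x) (humu x).1
    have hupp := (humu x).2 (umu y) (humu y).1
    have hlip := norm_maximizer_sub_le hσd hμ hstrong (humu x).1 (humu y).1 (humu x).2 (humu y).2
    have hcs := real_inner_le_norm (umu y - umu x) (W y - W x)
    have hW : ‖W y - W x‖ ≤ ‖W‖ * ‖y - x‖ := by
      rw [← map_sub]
      exact W.le_opNorm _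
    have hbound : ‖umu y - umu x‖ * ‖W y - W x‖ ≤ 2 / (μ * σd) * ‖W‖ ^ 2 * ‖y - x‖ ^ 2 :=
      calc ‖umu y - umu x‖ * ‖W y - W x‖
          ≤ 2 / (μ * σd) * ‖W y - W x‖ * ‖W y - W x‖ := by gcongr
        _ ≤ 2 / (μ * σd) * (‖W‖ * ‖y - x‖) * (‖W‖ * ‖y - x‖) := by gcongr
        _ = 2 / (μ * σd) * ‖W‖ ^ 2 * ‖y - x‖ ^ 2 := by ring
    rw [inner_sub_left, inner_sub_right, inner_sub_right] at hcs
    rw [hval, hval, ContinuousLinearMap.adjoint_inner_left, map_sub, inner_sub_right,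
      Real.norm_of_nonneg (by linarith), norm_pow, norm_norm]
    linarith
end

section
/- The gradient of f_μ(x) = max_{u ∈ Q_d} (⟨u, Wx⟩ − μ p_d(u)) is Lipschitz with constant L_μ = ‖W‖²/(μ σ_d): for all x, y ∈ ℝⁿ, ‖∇f_μ(x) − ∇f_μ(y)‖₂ ≤ (‖W‖²/(μ σ_d)) ‖x − y‖₂, where ‖W‖ is the operator norm of W. -/
open RealInnerProductSpace

/-- Quadratic growth at a maximizer of a linear functional minus a strongly convex function. -/
theorem StrongConvexOn.quadratic_growth_of_isMaxOn {E : Type*} [NormedAddCommGroup E]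
    [InnerProductSpace ℝ E] {Q : Set E} {f : E → ℝ} {σ μ : ℝ} (hf : StrongConvexOn Q σ f)
    (hμ : 0 ≤ μ) {c u v : E} (hu : u ∈ Q) (hv : v ∈ Q)
    (hmax : IsMaxOn (fun w => ⟪w, c⟫ - μ * f w) Q u) :
    μ * σ / 2 * ‖u - v‖ ^ 2 ≤ (⟪u, c⟫ - μ * f u) - (⟪v, c⟫ - μ * f v) := by
  set A := (⟪u, c⟫ - μ * f u) - (⟪v, c⟫ - μ * f v) with hA
  set B := μ * σ / 2 * ‖u - v‖ ^ 2 with hB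
  have hA0 : 0 ≤ A := sub_nonneg.2 (hmax hv)
  have key : ∀ t : ℝ, 0 < t → t ≤ 1 → (1 - t) * B ≤ A := by
    intro t ht ht1
    have h1 := hf.2 hu hv (sub_nonneg.2 ht1) ht.le (by ring)
    have h2 : ⟪(1 - t) • u + t • v, c⟫ - μ * f ((1 - t) • u + t • v) ≤ ⟪u, c⟫ - μ * f u :=
      hmax (hf.1 hu hv (sub_nonneg.2 ht1) ht.le (by ring))
    rw [inner_add_left, real_inner_smul_left, real_inner_smul_left] at h2
    have h3 := mul_le_mul_of_nonneg_left h1 hμ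
    simp only [smul_eq_mul] at h3
    refine le_of_mul_le_mul_left ?_ ht
    rw [hA, hB]
    linarith
  by_contra! hlt
  have hB0 : 0 < B := hA0.trans_lt hlt
  have h := key ((B - A) / (2 * B)) (div_pos (sub_pos.2 hlt) (by positivity))
    ((div_le_one (by positivity)).2 (by linarith))
  have heq : (1 - (B - A) / (2 * B)) * B = (A + B) / 2 := by
    field_simp
    ring
  linarith

/-- The gradient `∇f_μ(x) = W* u_μ(x)` of
`f_μ(x) = max_{u ∈ Q_d} (⟨u, Wx⟩ - μ p_d(u))` is Lipschitz with constant
`L_μ = ‖W‖²/(μ σ_d)`. -/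
theorem fmu_gradient_lipschitz {n p : ℕ}
    (Qd : Set (EuclideanSpace ℝ (Fin p)))
    (hQdne : Qd.Nonempty) (hQdcomp : IsCompact Qd) (hQdconv : Convex ℝ Qd)
    (pd : EuclideanSpace ℝ (Fin p) → ℝ) (hpd : Continuous pd)
    (σd : ℝ) (hσd : 0 < σd)
    (hstrong : ConvexOn ℝ Qd (fun u => pd u - σd / 2 * ‖u‖ ^ 2))
    (W : EuclideanSpace ℝ (Fin n) →L[ℝ] EuclideanSpace ℝ (Fin p))
    (μ : ℝ) (hμ : 0 < μ)
    (umu : EuclideanSpace ℝ (Fin n) → EuclideanSpace ℝ (Fin p))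
    (humu : ∀ x, umu x ∈ Qd ∧
      ∀ v ∈ Qd, ⟪v, W x⟫ - μ * pd v ≤ ⟪umu x, W x⟫ - μ * pd (umu x)) :
    ∀ x y : EuclideanSpace ℝ (Fin n),
      ‖ContinuousLinearMap.adjoint W (umu x) - ContinuousLinearMap.adjoint W (umu y)‖ ≤
        ‖W‖ ^ 2 / (μ * σd) * ‖x - y‖ := by
  intro x y
  have hf : StrongConvexOn Qd σd pd := strongConvexOn_iff_convex.2 hstrong
  have hx := hf.quadratic_growth_of_isMaxOn hμ.le (humu x).1 (humu y).1 (humu x).2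
  have hy := hf.quadratic_growth_of_isMaxOn hμ.le (humu y).1 (humu x).1 (humu y).2
  rw [norm_sub_rev] at hy
  rw [← map_sub]
  set d := umu x - umu y with hd
  set g := ContinuousLinearMap.adjoint W d with hg
  have hinner : ⟪g, x - y⟫ =
      ⟪umu x, W x⟫ - ⟪umu y, W x⟫ - (⟪umu x, W y⟫ - ⟪umu y, W y⟫) := by
    rw [hg, ContinuousLinearMap.adjoint_inner_left, map_sub, inner_sub_right, hd,
      inner_sub_left, inner_sub_left]
  have hmono : μ * σd * ‖d‖ ^ 2 ≤ ‖g‖ * ‖x - y‖ := by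
    linarith [real_inner_le_norm g (x - y)]
  have hgd : ‖g‖ ≤ ‖W‖ * ‖d‖ := by
    simpa using (ContinuousLinearMap.adjoint W).le_opNorm d
  rcases (norm_nonneg g).eq_or_lt with h0 | hpos
  · rw [← h0]
    positivity
  · have hμσ : 0 < μ * σd := mul_pos hμ hσd
    rw [div_mul_eq_mul_div, le_div_iff₀ hμσ]
    refine le_of_mul_le_mul_left ?_ hpos
    calc ‖g‖ * (‖g‖ * (μ * σd)) = ‖g‖ ^ 2 * (μ * σd) := by ring
      _ ≤ (‖W‖ * ‖d‖) ^ 2 * (μ * σd) := by gcongr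
      _ = ‖W‖ ^ 2 * (μ * σd * ‖d‖ ^ 2) := by ring
      _ ≤ ‖W‖ ^ 2 * (‖g‖ * ‖x - y‖) := by gcongr
      _ = ‖g‖ * (‖W‖ ^ 2 * ‖x - y‖) := by ring
end

section
/- Let A : ℝⁿ → ℝᵐ be a linear map whose rows are orthonormal, i.e., A A* = Id on ℝᵐ, let b ∈ ℝᵐ, let ε > 0, and let Q = { x ∈ ℝⁿ : ‖Ax − b‖₂ ≤ ε }. If q ∈ ℝⁿ satisfies ‖Aq − b‖₂ > ε, then the point y = q − (1 − ε/‖Aq − b‖₂) A*(Aq − b) lies in Q (with ‖Ay − b‖₂ = ε) and is the unique minimizer of x ↦ ‖x − q‖₂ over Q; if ‖Aq − b‖₂ ≤ ε, then q itself is the unique minimizer. -/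
open RealInnerProductSpace

/-- If the angle at `y` in the triangle `w`, `y`, `q` is not acute, then
`‖y - q‖ ^ 2 + ‖w - y‖ ^ 2 ≤ ‖w - q‖ ^ 2`. -/
theorem norm_sub_sq_add_norm_sub_sq_le_of_inner_nonpos {E : Type*} [NormedAddCommGroup E]
    [InnerProductSpace ℝ E] {w y q : E} (h : ⟪w - y, q - y⟫ ≤ 0) :
    ‖y - q‖ ^ 2 + ‖w - y‖ ^ 2 ≤ ‖w - q‖ ^ 2 := by
  have e : w - q = (w - y) - (q - y) := by abel
  rw [e, norm_sub_sq_real (w - y) (q - y), norm_sub_rev y q]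
  linarith

/-- If `A A* = Id`, then moving `q` by `-(1 - ε / ‖A q - b‖) A* (A q - b)` rescales the residual
`A q - b` by `ε / ‖A q - b‖`. -/
theorem residual_sub_smul_adjoint {E F : Type*} [NormedAddCommGroup E] [InnerProductSpace ℝ E]
    [CompleteSpace E] [NormedAddCommGroup F] [InnerProductSpace ℝ F] [CompleteSpace F]
    {A : E →L[ℝ] F} (hA : A.comp (ContinuousLinearMap.adjoint A) = ContinuousLinearMap.id ℝ F)
    (b : F) (ε : ℝ) (q : E) :
    A (q - (1 - ε / ‖A q - b‖) • ContinuousLinearMap.adjoint A (A q - b)) - b =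
      (ε / ‖A q - b‖) • (A q - b) := by
  have h : A (ContinuousLinearMap.adjoint A (A q - b)) = A q - b :=
    DFunLike.congr_fun hA (A q - b)
  rw [map_sub, map_smul, h]
  module

/-- The variational inequality characterizing the projection onto `{x | ‖A x - b‖ ≤ ε}`. -/
theorem inner_sub_residual_step_nonpos {E F : Type*} [NormedAddCommGroup E]
    [InnerProductSpace ℝ E] [CompleteSpace E] [NormedAddCommGroup F] [InnerProductSpace ℝ F]
    [CompleteSpace F] {A : E →L[ℝ] F}
    (hA : A.comp (ContinuousLinearMap.adjoint A) = ContinuousLinearMap.id ℝ F)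
    {b : F} {ε : ℝ} (hε : 0 < ε) {q w : E} (hq : ε < ‖A q - b‖) (hw : ‖A w - b‖ ≤ ε) :
    ⟪w - (q - (1 - ε / ‖A q - b‖) • ContinuousLinearMap.adjoint A (A q - b)),
      q - (q - (1 - ε / ‖A q - b‖) • ContinuousLinearMap.adjoint A (A q - b))⟫ ≤ 0 := by
  have hres := residual_sub_smul_adjoint hA b ε q
  have hpos : 0 < ‖A q - b‖ := hε.trans hq
  have ht : 0 ≤ 1 - ε / ‖A q - b‖ := sub_nonneg.2 ((div_le_one hpos).2 hq.le)
  set y := q - (1 - ε / ‖A q - b‖) • ContinuousLinearMap.adjoint A (A q - b) with hy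
  have hqy : q - y = (1 - ε / ‖A q - b‖) • ContinuousLinearMap.adjoint A (A q - b) := by
    rw [hy, sub_sub_cancel]
  have hAwy : A (w - y) = (A w - b) - (ε / ‖A q - b‖) • (A q - b) := by
    rw [← hres, map_sub]
    abel
  rw [hqy, inner_smul_right, ContinuousLinearMap.adjoint_inner_right, hAwy, inner_sub_left,
    real_inner_smul_left, real_inner_self_eq_norm_sq]
  refine mul_nonpos_of_nonneg_of_nonpos ht (sub_nonpos.2 ?_)
  calc ⟪A w - b, A q - b⟫ ≤ ‖A w - b‖ * ‖A q - b‖ := real_inner_le_norm _ _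
    _ ≤ ε * ‖A q - b‖ := by gcongr
    _ = ε / ‖A q - b‖ * ‖A q - b‖ ^ 2 := by field_simp

/-- Metric projection onto the feasible set `Q = {x : ‖Ax - b‖₂ ≤ ε}` when the
rows of `A` are orthonormal (`A A* = Id`). If `‖Aq - b‖₂ > ε` then
`y = q - (1 - ε/‖Aq - b‖₂) A*(Aq - b)` lies in `Q` with `‖Ay - b‖₂ = ε` and is
the unique minimizer of `x ↦ ‖x - q‖₂` over `Q`; if `‖Aq - b‖₂ ≤ ε` then `q`
itself is the unique minimizer. -/
theorem projection_onto_quadratic_constraint {n m : ℕ}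
    (A : EuclideanSpace ℝ (Fin n) →L[ℝ] EuclideanSpace ℝ (Fin m))
    (hA : A.comp (ContinuousLinearMap.adjoint A) =
      ContinuousLinearMap.id ℝ (EuclideanSpace ℝ (Fin m)))
    (b : EuclideanSpace ℝ (Fin m)) (ε : ℝ) (hε : 0 < ε)
    (q : EuclideanSpace ℝ (Fin n)) :
    (ε < ‖A q - b‖ →
      (‖A (q - (1 - ε / ‖A q - b‖) • ContinuousLinearMap.adjoint A (A q - b)) - b‖
          = ε ∧
        (q - (1 - ε / ‖A q - b‖) • ContinuousLinearMap.adjoint A (A q - b)) ∈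
          {x : EuclideanSpace ℝ (Fin n) | ‖A x - b‖ ≤ ε} ∧
        (∀ w ∈ {x : EuclideanSpace ℝ (Fin n) | ‖A x - b‖ ≤ ε},
          ‖(q - (1 - ε / ‖A q - b‖) • ContinuousLinearMap.adjoint A (A q - b)) - q‖
            ≤ ‖w - q‖) ∧
        (∀ y ∈ {x : EuclideanSpace ℝ (Fin n) | ‖A x - b‖ ≤ ε},
          (∀ w ∈ {x : EuclideanSpace ℝ (Fin n) | ‖A x - b‖ ≤ ε}, ‖y - q‖ ≤ ‖w - q‖) →
          y = q - (1 - ε / ‖A q - b‖) • ContinuousLinearMap.adjoint A (A q - b)))) ∧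
    (‖A q - b‖ ≤ ε →
      (q ∈ {x : EuclideanSpace ℝ (Fin n) | ‖A x - b‖ ≤ ε} ∧
        (∀ w ∈ {x : EuclideanSpace ℝ (Fin n) | ‖A x - b‖ ≤ ε}, ‖q - q‖ ≤ ‖w - q‖) ∧
        (∀ y ∈ {x : EuclideanSpace ℝ (Fin n) | ‖A x - b‖ ≤ ε},
          (∀ w ∈ {x : EuclideanSpace ℝ (Fin n) | ‖A x - b‖ ≤ ε}, ‖y - q‖ ≤ ‖w - q‖) →
          y = q))) := by
  refine ⟨fun hq => ?_, fun hq => ⟨hq, fun w _ => by simp, fun y _ hy => ?_⟩⟩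
  · have hpos : 0 < ‖A q - b‖ := hε.trans hq
    have hnorm :
        ‖A (q - (1 - ε / ‖A q - b‖) • ContinuousLinearMap.adjoint A (A q - b)) - b‖ = ε := by
      rw [residual_sub_smul_adjoint hA, norm_smul, Real.norm_of_nonneg (by positivity)]
      field_simp
    have key := fun w (hw : ‖A w - b‖ ≤ ε) =>
      norm_sub_sq_add_norm_sub_sq_le_of_inner_nonpos (inner_sub_residual_step_nonpos hA hε hq hw)
    refine ⟨hnorm, hnorm.le, fun w hw => ?_, fun y hy hmin => ?_⟩
    · refine (sq_le_sq₀ (norm_nonneg _) (norm_nonneg _)).1 ?_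
      exact (le_add_of_nonneg_right (sq_nonneg _)).trans (key w hw)
    · have hle := pow_le_pow_left₀ (norm_nonneg _) (hmin _ hnorm.le) 2
      rw [← sub_eq_zero, ← norm_eq_zero, ← sq_eq_zero_iff]
      exact le_antisymm (by linarith [key y hy]) (sq_nonneg _)
  · simpa [sub_eq_zero] using hy q hq
end
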